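/- arXiv:2305.02434 — 2 statements merged into one kernel-verified Lean document; each statement's English description precedes it below -/
import Mathlib

section
/- Assume p < 1/2. Let u ∈ (0,1) be any constant with 4C²/(u²α²) < z_{(1−u)α/2}². Define C̃ = min(C/√(p̂(1−p̂)), u√n·α/2) (with C̃ = u√n·α/2 when p̂ = 0 or p̂ = 1) and λ = 1 − 2C̃/(√n·α). Let N0 = max((4C/(uα))², 12 z_{(1−u)α/2}² C² / (z_{(1−u)α/2}² u²α² − 4C²)). Then for every integer n > N0, the upper bound p̂_u^{BE} = (1 + 2np̂/z_{λα/2}² + √(1 + 4np̂(1−p̂)/z_{λα/2}²)) / (2(1 + n/z_{λα/2}²)) satisfies P(p ≤ p̂_u^{BE}) ≥ 1 − α. -/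
open MeasureTheory

open scoped Classical in
/-- Probability that a Binomial(n,p) variable `X` satisfies predicate `Q`. -/
noncomputable def binProb (n : ℕ) (p : ℝ) (Q : ℕ → Prop) : ℝ :=
  ∑ k ∈ Finset.range (n + 1),
    if Q k then (n.choose k : ℝ) * p ^ k * (1 - p) ^ (n - k) else 0

/-- The standard normal CDF. -/
noncomputable def Phi (x : ℝ) : ℝ :=
  ∫ t in Set.Iic x, Real.exp (-(t ^ 2) / 2) / Real.sqrt (2 * Real.pi)

lemma integrable_Phi_integrand :
    Integrable (fun t : ℝ => Real.exp (-(t ^ 2) / 2) / Real.sqrt (2 * Real.pi)) := by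
  have h := (integrable_exp_neg_mul_sq (b := 1 / 2) (by norm_num)).div_const
    (Real.sqrt (2 * Real.pi))
  refine h.congr (Filter.Eventually.of_forall fun t => ?_)
  simp only
  congr 2
  ring

lemma Phi_mono : Monotone Phi := by
  intro a b hab
  refine setIntegral_mono_set integrable_Phi_integrand.integrableOn ?_ ?_
  · exact Filter.Eventually.of_forall fun t => by positivity
  · exact (Set.Iic_subset_Iic.mpr hab).eventuallyLE

lemma lt_of_Phi_lt {a b : ℝ} (h : Phi a < Phi b) : a < b :=
  Phi_mono.reflect_lt h

lemma Phi_zero : Phi 0 = 1 / 2 := by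
  have hneg := integral_comp_neg_Ioi (0 : ℝ)
    (fun t : ℝ => Real.exp (-(t ^ 2) / 2) / Real.sqrt (2 * Real.pi))
  rw [neg_zero] at hneg
  have hG := integral_gaussian_Ioi (1 / 2)
  have hpi : Real.pi / (1 / 2) = 2 * Real.pi := by ring
  rw [hpi] at hG
  have hfun : (fun t : ℝ => Real.exp (-(t ^ 2) / 2)) = fun t => Real.exp (-(1 / 2) * t ^ 2) := by
    funext t
    congr 1
    ring
  have hpos : 0 < Real.sqrt (2 * Real.pi) := by positivity
  unfold Phi
  rw [← hneg]
  simp only [neg_sq]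
  rw [integral_div, hfun, hG]
  field_simp

/-- If every outcome violating `Q` satisfies `R`, then `Q` has probability at least one minus that
of `R`. -/
lemma one_sub_binProb_le {n : ℕ} {p : ℝ} (hp0 : 0 ≤ p) (hp1 : p ≤ 1) {Q R : ℕ → Prop}
    (h : ∀ k, ¬ Q k → R k) : 1 - binProb n p R ≤ binProb n p Q := by
  classical
  have htot : ∑ k ∈ Finset.range (n + 1), (n.choose k : ℝ) * p ^ k * (1 - p) ^ (n - k) = 1 := by
    have := add_pow p (1 - p) n
    rw [add_sub_cancel, one_pow] at this
    refine Eq.trans ?_ this.symm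
    exact Finset.sum_congr rfl fun k _ => by ring
  rw [sub_le_iff_le_add, ← htot]
  unfold binProb
  rw [← Finset.sum_add_distrib]
  refine Finset.sum_le_sum fun k _ => ?_
  have hq : 0 ≤ 1 - p := by linarith
  have hk : 0 ≤ (n.choose k : ℝ) * p ^ k * (1 - p) ^ (n - k) := by positivity
  by_cases hQ : Q k
  · by_cases hR : R k <;> simp [hQ, hR, hk]
  · simp [hQ, h k hQ]

lemma binProb_mono {n : ℕ} {p : ℝ} (hp0 : 0 ≤ p) (hp1 : p ≤ 1) {Q R : ℕ → Prop}
    (h : ∀ k, Q k → R k) : binProb n p Q ≤ binProb n p R := by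
  classical
  unfold binProb
  refine Finset.sum_le_sum fun k _ => ?_
  have hq : 0 ≤ 1 - p := by linarith
  have hk : 0 ≤ (n.choose k : ℝ) * p ^ k * (1 - p) ^ (n - k) := by positivity
  by_cases hQ : Q k
  · simp [hQ, h k hQ]
  · by_cases hR : R k <;> simp [hQ, hR, hk]

lemma binProb_nonpos_of_forall_not {n : ℕ} {p : ℝ} {R : ℕ → Prop} (h : ∀ k, ¬ R k) :
    binProb n p R ≤ 0 := by
  simp [binProb, h]

/-- If `p < 1/2` exceeds the Wilson upper bound at level `z`, then the observed proportion `h` lies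
more than `|z|` standard deviations below `p`. -/
lemma lt_of_wilson_upper_lt {p h z n : ℝ} (hp : 0 < p) (hp2 : p < 1 / 2) (hn : 0 < n)
    (hz : z < 0)
    (hlt : (1 + 2 * n * h / z ^ 2 + Real.sqrt (1 + 4 * n * h * (1 - h) / z ^ 2)) /
      (2 * (1 + n / z ^ 2)) < p) :
    h < p + z * Real.sqrt (p * (1 - p) / n) := by
  have hz2 : 0 < z ^ 2 := sq_pos_of_neg hz
  obtain ⟨t, ht⟩ : ∃ t, t = n / z ^ 2 := ⟨_, rfl⟩
  have htpos : 0 < t := ht ▸ div_pos hn hz2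
  have e1 : 2 * n * h / z ^ 2 = 2 * t * h := by rw [ht]; ring
  have e2 : 4 * n * h * (1 - h) / z ^ 2 = 4 * t * h * (1 - h) := by rw [ht]; ring
  rw [e1, e2, ← ht, div_lt_iff₀ (by positivity)] at hlt
  have hs : Real.sqrt (1 + 4 * t * h * (1 - h)) < p * (2 * (1 + t)) - (1 + 2 * t * h) := by
    linarith
  have hs0 := (Real.sqrt_nonneg _).trans_lt hs
  have hhp : h < p := by
    by_contra hc
    push Not at hc
    nlinarith
  have hsq := Real.lt_sq_of_sqrt_lt hs
  have hquad : p * (1 - p) < t * (p - h) ^ 2 := by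
    have : 0 < (4 * (1 + t)) * (t * (p - h) ^ 2 - p * (1 - p)) := by nlinarith
    have := pos_of_mul_pos_right this (by positivity)
    linarith
  have hroot : -z * Real.sqrt (p * (1 - p) / n) < p - h := by
    refine lt_of_pow_lt_pow_left₀ 2 (by linarith) ?_
    have hpq : 0 ≤ p * (1 - p) / n := div_nonneg (by nlinarith) hn.le
    rw [mul_pow, Real.sq_sqrt hpq, neg_sq]
    rw [ht, div_mul_eq_mul_div, lt_div_iff₀ hz2] at hquad
    rw [← mul_div_assoc, div_lt_iff₀ hn]
    linarith
  linarith

/-- If `n p (1 - p) < a < w` and `n` is large enough, then `n p < w (1 - p)`. -/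
lemma mul_lt_mul_one_sub_of_variance_lt {p n a w : ℝ} (hp : 0 < p) (hp2 : p < 1 / 2) (hn : 0 < n)
    (haw : a < w) (hvar : n * (p * (1 - p)) < a) (hlarge : 3 * w * a / (w - a) < n) :
    n * p < w * (1 - p) := by
  have hpq : 0 < p * (1 - p) := mul_pos hp (by linarith)
  have ha : 0 < a := (mul_pos hn hpq).trans hvar
  rw [div_lt_iff₀ (by linarith)] at hlarge
  have h1 : 3 * w * (p * (1 - p)) < w - a := by
    have : n * (3 * w * (p * (1 - p))) < n * (w - a) := by nlinarith
    exact lt_of_mul_lt_mul_left this hn.le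
  have hw : 0 < w := ha.trans haw
  have h2 : a < w * (1 - p) ^ 2 := by
    have : 0 ≤ w * p * (1 - 2 * p) := mul_nonneg (by positivity) (by linarith)
    nlinarith
  have h3 : (n * p) * (1 - p) < (w * (1 - p)) * (1 - p) := by nlinarith
  exact lt_of_mul_lt_mul_right h3 (by linarith)

/-- If `n p < z² (1 - p)`, then the point `|z|` standard deviations below `p` is negative. -/
lemma add_mul_sqrt_neg {p n z : ℝ} (hp : 0 < p) (hn : 0 < n) (hz : z < 0)
    (hnp : n * p < z ^ 2 * (1 - p)) : p + z * Real.sqrt (p * (1 - p) / n) < 0 := by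
  have hq : 0 < 1 - p := pos_of_mul_pos_right ((mul_pos hn hp).trans hnp) (sq_nonneg z)
  have hroot : p < -z * Real.sqrt (p * (1 - p) / n) := by
    refine lt_of_pow_lt_pow_left₀ 2 (mul_nonneg (by linarith) (Real.sqrt_nonneg _)) ?_
    rw [mul_pow, Real.sq_sqrt (by positivity), neg_sq, ← mul_div_assoc, lt_div_iff₀ hn]
    nlinarith
  linarith

/-- For an observed proportion `h < p < 1/2`, the estimated Berry–Esseen correction is at least
the capped correction computed from `p`. -/
lemma min_le_relaxedCorrection_div {p h n α C u : ℝ} (hp2 : p < 1 / 2) (hC : 0 < C)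
    (hn : 0 < n) (hh0 : 0 ≤ h) (hhp : h < p) :
    min (C / Real.sqrt (n * p * (1 - p))) (u * α / 2) ≤
      (if h = 0 ∨ h = 1 then u * Real.sqrt n * α / 2
        else min (C / Real.sqrt (h * (1 - h))) (u * Real.sqrt n * α / 2)) / Real.sqrt n := by
  have hsn : 0 < Real.sqrt n := Real.sqrt_pos.mpr hn
  rw [le_div_iff₀ hsn]
  have hcap : min (C / Real.sqrt (n * p * (1 - p))) (u * α / 2) * Real.sqrt n ≤
      u * Real.sqrt n * α / 2 :=
    (mul_le_mul_of_nonneg_right (min_le_right _ _) hsn.le).trans_eq (by ring)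
  split_ifs with h01
  · exact hcap
  · refine le_min ?_ hcap
    rw [not_or] at h01
    have hpos : 0 < h := lt_of_le_of_ne hh0 (Ne.symm h01.1)
    have hq : 0 < h * (1 - h) := mul_pos hpos (by linarith)
    calc min (C / Real.sqrt (n * p * (1 - p))) (u * α / 2) * Real.sqrt n
        ≤ C / Real.sqrt (n * p * (1 - p)) * Real.sqrt n :=
          mul_le_mul_of_nonneg_right (min_le_left _ _) hsn.le
      _ = C / Real.sqrt (p * (1 - p)) := by
          rw [mul_assoc, Real.sqrt_mul hn.le]
          field_simp
      _ ≤ C / Real.sqrt (h * (1 - h)) := by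
          have := Real.sqrt_pos.mpr hq
          gcongr C / Real.sqrt ?_
          nlinarith

/-- assuming `p < 1/2` and the Berry–Esseen bound with constant `C`, for any
`u ∈ (0,1)` with `4C²/(u²α²) < z_{(1−u)α/2}²`, setting `C̃ = min(C/√(p̂(1−p̂)), u√n·α/2)`
(with `C̃ = u√n·α/2` when `p̂ = 0` or `p̂ = 1`), `λ = 1 − 2C̃/(√n·α)`, and
`N0 = max((4C/(uα))², 12 z² C²/(z² u²α² − 4C²))` where `z = z_{(1−u)α/2}`, for every
`n > N0` the relaxed Berry–Esseen upper bound `p̂_u^{BE}` satisfies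
`P(p ≤ p̂_u^{BE}) ≥ 1 − α`. -/
theorem stmt7 (p α C u : ℝ) (hp : 0 < p) (hp2 : p < 1 / 2)
    (hα : 0 < α) (hα1 : α < 1) (hC : 0 < C) (hu : 0 < u) (hu1 : u < 1)
    (zq : ℝ → ℝ) (hzq : ∀ q : ℝ, 0 < q → q < 1 → Phi (zq q) = q)
    (hucond : 4 * C ^ 2 / (u ^ 2 * α ^ 2) < (zq ((1 - u) * α / 2)) ^ 2)
    (hBE : ∀ n : ℕ, 1 ≤ n → ∀ x : ℝ,
      |binProb n p (fun k => (k : ℝ) ≤ n * x)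
          - Phi ((x - p) * Real.sqrt (n / (p * (1 - p))))|
        ≤ C / Real.sqrt (n * p * (1 - p)) ∧
      |binProb n p (fun k => (k : ℝ) ≥ n * x)
          - Phi ((p - x) * Real.sqrt (n / (p * (1 - p))))|
        ≤ C / Real.sqrt (n * p * (1 - p))) :
    ∀ n : ℕ,
      (n : ℝ) > max ((4 * C / (u * α)) ^ 2)
        (12 * (zq ((1 - u) * α / 2)) ^ 2 * C ^ 2 /
          ((zq ((1 - u) * α / 2)) ^ 2 * u ^ 2 * α ^ 2 - 4 * C ^ 2)) →
      binProb n p (fun k =>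
        let phat : ℝ := (k : ℝ) / n
        let Ctil : ℝ :=
          if phat = 0 ∨ phat = 1 then u * Real.sqrt n * α / 2
          else min (C / Real.sqrt (phat * (1 - phat))) (u * Real.sqrt n * α / 2)
        let lam : ℝ := 1 - 2 * Ctil / (Real.sqrt n * α)
        let z : ℝ := zq (lam * α / 2)
        p ≤ (1 + 2 * n * phat / z ^ 2 + Real.sqrt (1 + 4 * n * phat * (1 - phat) / z ^ 2)) /
              (2 * (1 + (n : ℝ) / z ^ 2))) ≥ 1 - α := by
  intro n hn
  obtain ⟨hn1, hn2⟩ := max_lt_iff.mp hn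
  have hn0 : (0 : ℝ) < n := (sq_nonneg _).trans_lt hn1
  have hnat : 1 ≤ n := by exact_mod_cast hn0
  have hsn : 0 < Real.sqrt n := Real.sqrt_pos.mpr hn0
  have hpq : 0 < p * (1 - p) := mul_pos hp (by linarith)
  have hnpq : 0 < (n : ℝ) * p * (1 - p) := by rw [mul_assoc]; positivity
  have hs : 0 < Real.sqrt (n * p * (1 - p)) := Real.sqrt_pos.mpr hnpq
  have hua : 0 < u * α := mul_pos hu hα
  have hua1 : u * α < α := by nlinarith
  set E := C / Real.sqrt (n * p * (1 - p)) with hE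
  have hEpos : 0 < E := div_pos hC hs
  have hzneg : ∀ q, 0 < q → q < 1 / 2 → zq q < 0 := fun q h0 h1 =>
    lt_of_Phi_lt (by rw [hzq q h0 (by linarith), Phi_zero]; exact h1)
  have hzmono : ∀ q r, 0 < q → q ≤ r → r < 1 → zq q ≤ zq r := by
    intro q r h0 hqr h1
    rcases hqr.eq_or_lt with rfl | hlt
    · exact le_rfl
    · exact (lt_of_Phi_lt (by rwa [hzq q h0 (by linarith), hzq r (by linarith) h1])).le
  have hm0 : 0 < min E (u * α / 2) := lt_min hEpos (by linarith)
  have hm1 : min E (u * α / 2) ≤ u * α / 2 := min_le_right _ _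
  set β := α / 2 - min E (u * α / 2) with hβ
  have hβ0 : 0 < β := by linarith
  have hβ1 : β < 1 / 2 := by linarith
  set x := p + zq β * Real.sqrt (p * (1 - p) / n) with hx
  have hfail : binProb n p (fun k => (k : ℝ) < n * x) ≤ α := by
    rcases le_or_gt E (u * α / 2) with hsmall | hbig
    · have hBEx := (abs_le.mp (hBE n hnat x).1).2
      have harg : (x - p) * Real.sqrt (n / (p * (1 - p))) = zq β := by
        rw [hx, add_sub_cancel_left, mul_assoc, ← Real.sqrt_mul (by positivity),
          div_mul_div_cancel₀ hn0.ne', div_self hpq.ne', Real.sqrt_one, mul_one]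
      rw [harg, hzq β hβ0 (by linarith)] at hBEx
      rw [min_eq_left hsmall] at hβ
      have hle : binProb n p (fun k => (k : ℝ) < n * x) ≤
          binProb n p (fun k => (k : ℝ) ≤ n * x) :=
        binProb_mono hp.le (by linarith) fun k hk => hk.le
      linarith
    · have hβu : β = (1 - u) * α / 2 := by
        rw [hβ, min_eq_right hbig.le]
        ring
      rw [← hβu] at hucond hn2
      have hvar : (n : ℝ) * (p * (1 - p)) < 4 * C ^ 2 / (u ^ 2 * α ^ 2) := by
        rw [hE, lt_div_iff₀ hs] at hbig
        have h2 : (u * α / 2 * Real.sqrt (n * p * (1 - p))) ^ 2 < C ^ 2 :=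
          pow_lt_pow_left₀ hbig (by positivity) two_ne_zero
        rw [mul_pow, Real.sq_sqrt hnpq.le] at h2
        rw [lt_div_iff₀ (by positivity)]
        linarith
      have hlarge : 3 * zq β ^ 2 * (4 * C ^ 2 / (u ^ 2 * α ^ 2)) /
          (zq β ^ 2 - 4 * C ^ 2 / (u ^ 2 * α ^ 2)) < n := by
        refine lt_of_eq_of_lt ?_ hn2
        have h1 : zq β ^ 2 - 4 * C ^ 2 / (u ^ 2 * α ^ 2) =
            (zq β ^ 2 * u ^ 2 * α ^ 2 - 4 * C ^ 2) / (u ^ 2 * α ^ 2) := by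
          field_simp
        rw [h1, ← mul_div_assoc, div_div_div_cancel_right₀ (by positivity)]
        ring
      have hnp := mul_lt_mul_one_sub_of_variance_lt hp hp2 hn0 hucond hvar hlarge
      have hx0 : x < 0 := add_mul_sqrt_neg hp hn0 (hzneg β hβ0 hβ1) hnp
      refine (binProb_nonpos_of_forall_not fun k => ?_).trans hα.le
      exact not_lt.mpr ((mul_neg_of_pos_of_neg hn0 hx0).le.trans k.cast_nonneg)
  refine (sub_le_sub_left hfail 1).trans (one_sub_binProb_le (R := fun k => (k : ℝ) < n * x) hp.le
    (by linarith) fun k hk => ?_)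
  simp only [not_le] at hk
  set phat : ℝ := (k : ℝ) / n with hphat
  have hphat0 : 0 ≤ phat := div_nonneg k.cast_nonneg hn0.le
  set Ctil : ℝ := if phat = 0 ∨ phat = 1 then u * Real.sqrt n * α / 2
    else min (C / Real.sqrt (phat * (1 - phat))) (u * Real.sqrt n * α / 2) with hCtil
  have hCtil0 : 0 ≤ Ctil := by
    rw [hCtil]
    split_ifs <;> positivity
  have hCtil1 : Ctil ≤ u * Real.sqrt n * α / 2 := by
    rw [hCtil]
    split_ifs
    exacts [le_rfl, min_le_right _ _]
  have hlam : (1 - 2 * Ctil / (Real.sqrt n * α)) * α / 2 = α / 2 - Ctil / Real.sqrt n := by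
    field_simp
  rw [hlam] at hk
  have hr0 : 0 ≤ Ctil / Real.sqrt n := by positivity
  have hr1 : Ctil / Real.sqrt n ≤ u * α / 2 := by
    rw [div_le_iff₀ hsn]
    linarith
  have hz := hzneg (α / 2 - Ctil / Real.sqrt n) (by linarith) (by linarith)
  have hlt := lt_of_wilson_upper_lt hp hp2 hn0 hz hk
  have hphatp : phat < p := hlt.trans_le <| by
    have := mul_nonneg (neg_nonneg.mpr hz.le) (Real.sqrt_nonneg (p * (1 - p) / n))
    linarith
  have hmin : min E (u * α / 2) ≤ Ctil / Real.sqrt n :=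
    min_le_relaxedCorrection_div hp2 hC hn0 hphat0 hphatp
  have hzle := hzmono (α / 2 - Ctil / Real.sqrt n) β (by linarith) (by linarith) (by linarith)
  have hphatx : phat < x := hlt.trans_le
    (add_le_add_right (mul_le_mul_of_nonneg_right hzle (Real.sqrt_nonneg _)) p)
  rwa [hphat, div_lt_iff₀' hn0] at hphatx
end

section
/- For every real x with n0 < x < n0/p, the lower tail satisfies P(N ≤ x) ≤ (1−p)^{x−n0} · x^x · p^{n0} / ((x−n0)^{x−n0} · n0^{n0}), where the powers with real exponents are real powers of positive bases. -/
open scoped Classical in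
/-- Probability that the negative-binomial sample size `N` (number of Bernoulli(p) trials
until `n0` successes) satisfies predicate `Q`. -/
noncomputable def nbProb (n0 : ℕ) (p : ℝ) (Q : ℕ → Prop) : ℝ :=
  ∑' k : ℕ,
    if Q (n0 + k) then ((n0 + k - 1).choose (n0 - 1) : ℝ) * p ^ n0 * (1 - p) ^ k else 0

/-- The negative binomial series, indexed by the number of failures. -/
lemma hasSum_negBinomial {n0 : ℕ} (hn0 : 1 ≤ n0) {r : ℝ} (hr0 : 0 ≤ r) (hr1 : r < 1) :
    HasSum (fun k : ℕ => ((n0 + k - 1).choose (n0 - 1) : ℝ) * r ^ k) (1 / (1 - r) ^ n0) := by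
  obtain ⟨m, rfl⟩ := Nat.exists_eq_add_of_le' hn0
  have hr : ‖r‖ < 1 := by rwa [Real.norm_of_nonneg hr0]
  refine (hasSum_choose_mul_geometric_of_norm_lt_one m hr).congr_fun fun k => ?_
  rw [show m + 1 + k - 1 = k + m by omega, Nat.add_sub_cancel]

/-- Exponential-tilting bound for the lower tail, for any tilted failure probability `r ≤ 1 - p`. -/
lemma nbProb_le_tilted {n0 : ℕ} (hn0 : 1 ≤ n0) {p r x : ℝ} (hp : 0 < p)
    (hr0 : 0 < r) (hr1 : r < 1) (hrp : r ≤ 1 - p) :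
    nbProb n0 p (fun m => (m : ℝ) ≤ x) ≤
      p ^ n0 * ((1 - p) / r) ^ (x - (n0 : ℝ)) * (1 / (1 - r) ^ n0) := by
  have hs := (hasSum_negBinomial hn0 hr0.le hr1).mul_left
    (p ^ n0 * ((1 - p) / r) ^ (x - (n0 : ℝ)))
  have hq : 0 < 1 - p := hr0.trans_le hrp
  have hratio : 1 ≤ (1 - p) / r := (one_le_div hr0).2 hrp
  have hnonneg : ∀ k : ℕ, 0 ≤ (if ((n0 + k : ℕ) : ℝ) ≤ x then
      ((n0 + k - 1).choose (n0 - 1) : ℝ) * p ^ n0 * (1 - p) ^ k else 0) := by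
    intro k
    split_ifs <;> positivity
  have hle : ∀ k : ℕ, (if ((n0 + k : ℕ) : ℝ) ≤ x then
      ((n0 + k - 1).choose (n0 - 1) : ℝ) * p ^ n0 * (1 - p) ^ k else 0) ≤
      p ^ n0 * ((1 - p) / r) ^ (x - (n0 : ℝ)) *
        (((n0 + k - 1).choose (n0 - 1) : ℝ) * r ^ k) := by
    intro k
    split_ifs with h
    · have hk : ((1 - p) / r) ^ k ≤ ((1 - p) / r) ^ (x - (n0 : ℝ)) := by
        rw [← Real.rpow_natCast]
        refine Real.rpow_le_rpow_of_exponent_le hratio ?_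
        push_cast at h
        linarith
      calc ((n0 + k - 1).choose (n0 - 1) : ℝ) * p ^ n0 * (1 - p) ^ k
          = p ^ n0 * ((1 - p) / r) ^ k * (((n0 + k - 1).choose (n0 - 1) : ℝ) * r ^ k) := by
            rw [div_pow]
            field_simp
        _ ≤ _ := by gcongr
    · positivity
  rw [← hs.tsum_eq]
  unfold nbProb
  convert (Summable.of_nonneg_of_le hnonneg hle hs.summable).tsum_le_tsum hle hs.summable

/-- for every real `x` with `n0 < x < n0/p`, the lower-tail Chernoff bound
`P(N ≤ x) ≤ (1−p)^{x−n0} x^x p^{n0} / ((x−n0)^{x−n0} n0^{n0})` holds, where powers with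
real exponents are real (`rpow`) powers of positive bases. -/
theorem stmt16 (n0 : ℕ) (hn0 : 1 ≤ n0) (p : ℝ) (hp : 0 < p) (hp1 : p < 1)
    (x : ℝ) (hx1 : (n0 : ℝ) < x) (hx2 : x < (n0 : ℝ) / p) :
    nbProb n0 p (fun m => (m : ℝ) ≤ x) ≤
      (1 - p) ^ (x - (n0 : ℝ)) * x ^ x * p ^ n0 /
        ((x - (n0 : ℝ)) ^ (x - (n0 : ℝ)) * (n0 : ℝ) ^ n0) := by
  have hn : (0 : ℝ) < n0 := by exact_mod_cast hn0
  have hx : 0 < x := hn.trans hx1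
  have hy : 0 < x - n0 := sub_pos.2 hx1
  have hq : 0 < 1 - p := sub_pos.2 hp1
  rw [lt_div_iff₀ hp] at hx2
  have hr1 : (x - n0) / x < 1 := (div_lt_one hx).2 (by linarith)
  have hrp : (x - n0) / x ≤ 1 - p := (div_le_iff₀ hx).2 (by linarith)
  refine (nbProb_le_tilted hn0 hp (div_pos hy hx) hr1 hrp).trans_eq ?_
  have hone : 1 - (x - n0) / x = n0 / x := by
    field_simp
    ring
  have hxx : x ^ x = x ^ (x - (n0 : ℝ)) * x ^ n0 := by
    rw [← Real.rpow_natCast x n0, ← Real.rpow_add hx, sub_add_cancel]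
  rw [hone, hxx, div_div_eq_mul_div, Real.div_rpow (mul_pos hq hx).le hy.le,
    Real.mul_rpow hq.le hx.le, div_pow]
  have hyy : 0 < (x - (n0 : ℝ)) ^ (x - (n0 : ℝ)) := Real.rpow_pos_of_pos hy _
  field_simp
end
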